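/- Let ψ(x) = exp(−‖x‖²) for x ∈ ℝ^d, let α ∈ (1,2), and let X_α be a rotationally invariant α-stable random vector in ℝ^d with characteristic function φ(ξ) = exp(−‖ξ‖^α/2), Lévy measure ν_α(du) = c_{α,d}‖u‖^{−d−α}du and ν̃_α = α ν_α. For R ≥ 1 and j ∈ {1,…,d} let g_{R,j}(x) = x_j ψ(x/R), and let Γ(f,f)(x) = ½ ∫ (f(x+u) − f(x))² ν̃_α(du). Then for every j, lim_{R→∞} E[Γ(g_{R,j}, g_{R,j})(X_α)]/R^{2−α} = (α²/4)(2π)^{−2d} ∫∫ F(ψ)(ξ) F(ψ)(ζ) ( ‖ξ+ζ‖^{α−2} + (ξ_j+ζ_j)² (α−2) ‖ξ+ζ‖^{α−4} ) dξ dζ. -/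

import Mathlib

open MeasureTheory ProbabilityTheory Filter Set
open scoped RealInnerProductSpace ENNReal NNReal Topology

noncomputable section

/-- The normalizing constant `c_{α,d}` of the rotationally invariant `α`-stable law. -/
def stableCst (d : ℕ) (α : ℝ) : ℝ :=
  -α * (α - 1) * Real.Gamma ((α + d) / 2) /
    (4 * Real.cos (α * Real.pi / 2) * Real.Gamma ((α + 1) / 2) *
      Real.pi ^ (((d : ℝ) - 1) / 2) * Real.Gamma (2 - α))

/-- The Lévy measure `ν_α(du) = c_{α,d} ‖u‖^{−d−α} du`. -/
def stableLevy (d : ℕ) (α : ℝ) : Measure (EuclideanSpace ℝ (Fin d)) :=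
  volume.withDensity fun u => ENNReal.ofReal (stableCst d α / ‖u‖ ^ ((d : ℝ) + α))

/-- `ν̃_α = α ν_α`. -/
def stableLevyTilde (d : ℕ) (α : ℝ) : Measure (EuclideanSpace ℝ (Fin d)) :=
  (ENNReal.ofReal α) • stableLevy d α

/-- The characteristic function of a measure on `ℝ^d`. -/
def charFn {d : ℕ} (μ : Measure (EuclideanSpace ℝ (Fin d)))
    (ξ : EuclideanSpace ℝ (Fin d)) : ℂ :=
  ∫ x, Complex.exp (Complex.I * (⟪ξ, x⟫ : ℂ)) ∂μ

/-- The Fourier transform `F(f)(ξ) = ∫ f(x) e^{−i⟨ξ,x⟩} dx` of a real function on `ℝ^d`. -/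
def FT {d : ℕ} (f : EuclideanSpace ℝ (Fin d) → ℝ) (ξ : EuclideanSpace ℝ (Fin d)) : ℂ :=
  ∫ y, (f y : ℂ) * Complex.exp (-(Complex.I * ((⟪ξ, y⟫ : ℝ) : ℂ)))

variable {d : ℕ}

lemma abs_mul_exp_neg_sq_le_one (t : ℝ) : |t * Real.exp (-t ^ 2)| ≤ 1 := by
  have h := Real.abs_mulExpNegMulSq_one_le_one t
  rwa [Real.mulExpNegSq_apply, one_mul, ← sq] at h

lemma abs_mul_exp_neg_sq_sub_le (a b : ℝ) :
    |a * Real.exp (-a ^ 2) - b * Real.exp (-b ^ 2)| ≤ |a - b| := by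
  have h := (Real.lipschitzWith_one_mulExpNegMulSq one_pos).dist_le_mul a b
  simpa only [Real.dist_eq, Real.mulExpNegSq_apply, one_mul, ← sq, NNReal.coe_one] using h

/-- The function `x ↦ x_j exp(−‖x‖²)`. -/
def gaussCoord (j : Fin d) (x : EuclideanSpace ℝ (Fin d)) : ℝ :=
  x j * Real.exp (-‖x‖ ^ 2)

lemma continuous_gaussCoord (j : Fin d) : Continuous (gaussCoord j) := by
  unfold gaussCoord
  fun_prop

lemma abs_gaussCoord_le_one (j : Fin d) (x : EuclideanSpace ℝ (Fin d)) :
    |gaussCoord j x| ≤ 1 := by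
  have h := abs_mul_exp_neg_sq_le_one ‖x‖
  have hj : |x j| ≤ ‖x‖ := PiLp.norm_apply_le x j
  rw [abs_mul, abs_norm] at h
  rw [gaussCoord, abs_mul]
  exact (mul_le_mul_of_nonneg_right hj (abs_nonneg _)).trans h

lemma abs_gaussCoord_sub_le (j : Fin d) (x y : EuclideanSpace ℝ (Fin d)) :
    |gaussCoord j x - gaussCoord j y| ≤ 3 * ‖x - y‖ := by
  have hxy : |x j - y j| ≤ ‖x - y‖ := PiLp.norm_apply_le (x - y) j
  have hx : |x j| ≤ ‖x‖ := PiLp.norm_apply_le x j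
  have hn : |‖x‖ - ‖y‖| ≤ ‖x - y‖ := abs_norm_sub_norm_le x y
  set p := Real.exp (-‖x‖ ^ 2) with hp
  set q := Real.exp (-‖y‖ ^ 2) with hq
  have hq1 : |q| ≤ 1 := by
    rw [abs_of_pos (Real.exp_pos _), Real.exp_le_one_iff]
    exact neg_nonpos.2 (sq_nonneg _)
  have h1 : |‖x‖ * p - ‖y‖ * q| ≤ |‖x‖ - ‖y‖| := abs_mul_exp_neg_sq_sub_le _ _
  have h2 : |‖x‖ * (p - q)| ≤ 2 * ‖x - y‖ := by
    have e : ‖x‖ * (p - q) = (‖x‖ * p - ‖y‖ * q) - (‖x‖ - ‖y‖) * q := by ring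
    have h3 : |(‖x‖ - ‖y‖) * q| ≤ ‖x - y‖ := by
      rw [abs_mul]
      exact (mul_le_of_le_one_right (abs_nonneg _) hq1).trans hn
    rw [e]
    refine (abs_sub _ _).trans ?_
    linarith
  have h4 : |x j * (p - q)| ≤ 2 * ‖x - y‖ := by
    rw [abs_mul, abs_norm] at h2
    rw [abs_mul]
    exact (mul_le_mul_of_nonneg_right hx (abs_nonneg _)).trans h2
  have h5 : |(x j - y j) * q| ≤ ‖x - y‖ := by
    rw [abs_mul]
    exact (mul_le_of_le_one_right (abs_nonneg _) hq1).trans hxy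
  have e : gaussCoord j x - gaussCoord j y = x j * (p - q) + (x j - y j) * q := by
    simp only [gaussCoord, ← hp, ← hq]; ring
  rw [e]
  refine (abs_add_le _ _).trans ?_
  linarith

lemma sq_gaussCoord_sub_le (j : Fin d) (y v : EuclideanSpace ℝ (Fin d)) :
    (gaussCoord j (y + v) - gaussCoord j y) ^ 2 ≤ min (9 * ‖v‖ ^ 2) 4 := by
  have h := abs_gaussCoord_sub_le j (y + v) y
  rw [add_sub_cancel_left] at h
  have h2 : |gaussCoord j (y + v) - gaussCoord j y| ≤ 2 := by
    have := abs_sub (gaussCoord j (y + v)) (gaussCoord j y)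
    linarith [abs_gaussCoord_le_one j (y + v), abs_gaussCoord_le_one j y]
  rw [← sq_abs, le_min_iff]
  constructor
  · calc _ ≤ (3 * ‖v‖) ^ 2 := by gcongr
      _ = _ := by ring
  · calc _ ≤ (2 : ℝ) ^ 2 := by gcongr
      _ = _ := by norm_num

lemma nontrivial_euclideanSpace_of_pos (hd : 0 < d) : Nontrivial (EuclideanSpace ℝ (Fin d)) :=
  Module.nontrivial_of_finrank_pos (R := ℝ) (by simpa using hd)

lemma pow_pred_mul_rpow (hd : 0 < d) {r : ℝ} (hr : 0 < r) (s : ℝ) :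
    r ^ (d - 1) * r ^ s = r ^ (s + d - 1) := by
  rw [← Real.rpow_natCast, Nat.cast_sub hd, ← Real.rpow_add hr]
  congr 1
  push_cast
  ring

lemma integrable_min_sq_div_norm_rpow (hd : 0 < d) {α : ℝ} (hα0 : 0 < α) (hα : α < 2)
    {a b : ℝ} (ha : 0 ≤ a) (hb : 0 ≤ b) :
    Integrable fun v : EuclideanSpace ℝ (Fin d) =>
      min (a * ‖v‖ ^ 2) b / ‖v‖ ^ ((d : ℝ) + α) := by
  have := nontrivial_euclideanSpace_of_pos hd
  refine (integrable_fun_norm_addHaar (volume : Measure (EuclideanSpace ℝ (Fin d)))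
    (f := fun r => min (a * r ^ 2) b / r ^ ((d : ℝ) + α))).2 ?_
  rw [finrank_euclideanSpace_fin, ← Ioc_union_Ioi_eq_Ioi zero_le_one]
  have key : ∀ r : ℝ, 0 < r → r ^ (d - 1) • (min (a * r ^ 2) b / r ^ ((d : ℝ) + α)) =
      min (a * r ^ 2) b * r ^ (-1 - α) := by
    intro r hr
    rw [smul_eq_mul, div_eq_mul_inv, ← Real.rpow_neg hr.le, mul_left_comm,
      pow_pred_mul_rpow hd hr]
    congr 2
    ring
  have meas : Measurable fun r : ℝ => r ^ (d - 1) • (min (a * r ^ 2) b / r ^ ((d : ℝ) + α)) := by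
    fun_prop
  refine IntegrableOn.union ?_ ?_
  · have h := (intervalIntegrable_iff_integrableOn_Ioc_of_le zero_le_one).1
      (intervalIntegral.intervalIntegrable_rpow' (a := 0) (b := 1) (r := 1 - α) (by linarith))
    refine Integrable.mono' (h.const_mul a) meas.aestronglyMeasurable ?_
    filter_upwards [ae_restrict_mem measurableSet_Ioc] with r hr
    have hr0 : 0 < r := hr.1
    rw [key r hr0, Real.norm_of_nonneg (by positivity)]
    calc _ ≤ (a * r ^ 2) * r ^ (-1 - α) := by gcongr; exact min_le_left _ _
      _ = a * r ^ (1 - α) := by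
        rw [mul_assoc, ← Real.rpow_natCast, ← Real.rpow_add hr0]
        congr 2
        push_cast
        ring
  · have h := integrableOn_Ioi_rpow_of_lt (a := -1 - α) (by linarith) one_pos
    refine Integrable.mono' (h.const_mul b) meas.aestronglyMeasurable ?_
    filter_upwards [ae_restrict_mem measurableSet_Ioi] with r hr
    have hr0 : 0 < r := zero_lt_one.trans hr
    rw [key r hr0, Real.norm_of_nonneg (by positivity)]
    gcongr
    exact min_le_right _ _

/-- The integral `∫ (g(y+v) − g(y))² ‖v‖^{−d−α} dv` for `g = gaussCoord j`. -/
def jumpEnergy (α : ℝ) (j : Fin d) (y : EuclideanSpace ℝ (Fin d)) : ℝ :=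
  ∫ v, (gaussCoord j (y + v) - gaussCoord j y) ^ 2 / ‖v‖ ^ ((d : ℝ) + α)

lemma norm_sq_gaussCoord_sub_div_le (α : ℝ) (j : Fin d) (y v : EuclideanSpace ℝ (Fin d)) :
    ‖(gaussCoord j (y + v) - gaussCoord j y) ^ 2 / ‖v‖ ^ ((d : ℝ) + α)‖ ≤
      min (9 * ‖v‖ ^ 2) 4 / ‖v‖ ^ ((d : ℝ) + α) := by
  rw [Real.norm_of_nonneg (by positivity)]
  gcongr
  exact sq_gaussCoord_sub_le j y v

lemma continuous_jumpEnergy (hd : 0 < d) {α : ℝ} (hα0 : 0 < α) (hα : α < 2) (j : Fin d) :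
    Continuous (jumpEnergy α j) := by
  have hg := continuous_gaussCoord j
  refine continuous_of_dominated (fun y => ?_)
    (fun y => .of_forall fun v => norm_sq_gaussCoord_sub_div_le α j y v)
    (integrable_min_sq_div_norm_rpow hd hα0 hα (by norm_num) (by norm_num))
    (.of_forall fun v => by fun_prop)
  have := hg.measurable
  exact Measurable.aestronglyMeasurable (by fun_prop)

lemma norm_jumpEnergy_le (hd : 0 < d) {α : ℝ} (hα0 : 0 < α) (hα : α < 2) (j : Fin d)
    (y : EuclideanSpace ℝ (Fin d)) :
    ‖jumpEnergy α j y‖ ≤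
      ∫ v : EuclideanSpace ℝ (Fin d), min (9 * ‖v‖ ^ 2) 4 / ‖v‖ ^ ((d : ℝ) + α) :=
  norm_integral_le_of_norm_le
    (integrable_min_sq_div_norm_rpow hd hα0 hα (by norm_num) (by norm_num))
    (.of_forall fun v => norm_sq_gaussCoord_sub_div_le α j y v)

lemma tendsto_integral_jumpEnergy (hd : 0 < d) {α : ℝ} (hα0 : 0 < α) (hα : α < 2) (j : Fin d)
    (μ : Measure (EuclideanSpace ℝ (Fin d))) [IsProbabilityMeasure μ] :
    Tendsto (fun R : ℝ => ∫ x, jumpEnergy α j (R⁻¹ • x) ∂μ) atTop (𝓝 (jumpEnergy α j 0)) := by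
  have hc := continuous_jumpEnergy hd hα0 hα j
  have h : Tendsto (fun R : ℝ => ∫ x, jumpEnergy α j (R⁻¹ • x) ∂μ) atTop
      (𝓝 (∫ _, jumpEnergy α j 0 ∂μ)) := by
    refine tendsto_integral_filter_of_dominated_convergence _ (.of_forall fun R => ?_)
      (.of_forall fun R => .of_forall fun x => norm_jumpEnergy_le hd hα0 hα j _)
      (integrable_const _) (.of_forall fun x => ?_)
    · exact (hc.comp (by fun_prop)).aestronglyMeasurable
    · refine hc.continuousAt.tendsto.comp ?_
      simpa using (tendsto_inv_atTop_zero (𝕜 := ℝ)).smul_const x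
  simpa using h

lemma stableCst_pos {α : ℝ} (hα : α ∈ Ioo (1 : ℝ) 2) (d : ℕ) : 0 < stableCst d α := by
  obtain ⟨h1, h2⟩ := hα
  have hcos : Real.cos (α * Real.pi / 2) < 0 := by
    apply Real.cos_neg_of_pi_div_two_lt_of_lt <;> nlinarith [Real.pi_pos]
  have hΓ1 : 0 < Real.Gamma ((α + d) / 2) := Real.Gamma_pos_of_pos (by positivity)
  have hΓ2 : 0 < Real.Gamma ((α + 1) / 2) := Real.Gamma_pos_of_pos (by positivity)
  have hΓ3 : 0 < Real.Gamma (2 - α) := Real.Gamma_pos_of_pos (by linarith)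
  have hπ : 0 < Real.pi ^ (((d : ℝ) - 1) / 2) := Real.rpow_pos_of_pos Real.pi_pos _
  unfold stableCst
  apply div_pos_of_neg_of_neg
  · have : 0 < α * (α - 1) * Real.Gamma ((α + d) / 2) := by
      have : 0 < α - 1 := by linarith
      positivity
    linarith
  · have := mul_pos (mul_pos (mul_pos hΓ2 hπ) hΓ3) (neg_pos.2 hcos)
    linarith

lemma integral_stableLevyTilde {α : ℝ} (hα : α ∈ Ioo (1 : ℝ) 2)
    (f : EuclideanSpace ℝ (Fin d) → ℝ) :
    ∫ u, f u ∂(stableLevyTilde d α) =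
      α * stableCst d α * ∫ u, f u / ‖u‖ ^ ((d : ℝ) + α) := by
  have hc := (stableCst_pos hα d).le
  have hα0 : 0 ≤ α := by linarith [hα.1]
  rw [stableLevyTilde, integral_smul_measure, stableLevy,
    integral_withDensity_eq_integral_toReal_smul (by fun_prop) (by simp),
    ENNReal.toReal_ofReal hα0, smul_eq_mul, mul_assoc,
    ← integral_const_mul (stableCst d α)]
  refine congrArg (α * ·) (integral_congr_ae (.of_forall fun u => ?_))
  beta_reduce
  rw [ENNReal.toReal_ofReal (by positivity), smul_eq_mul]
  ring

lemma integral_scaled_jump (α : ℝ) (j : Fin d) (x : EuclideanSpace ℝ (Fin d)) {R : ℝ}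
    (hR : 0 < R) :
    ∫ u : EuclideanSpace ℝ (Fin d),
        ((x + u) j * Real.exp (-‖R⁻¹ • (x + u)‖ ^ 2) - x j * Real.exp (-‖R⁻¹ • x‖ ^ 2)) ^ 2 /
          ‖u‖ ^ ((d : ℝ) + α) =
      R ^ (2 - α) * jumpEnergy α j (R⁻¹ • x) := by
  have h := Measure.integral_comp_smul (volume : Measure (EuclideanSpace ℝ (Fin d)))
    (fun u => ((x + u) j * Real.exp (-‖R⁻¹ • (x + u)‖ ^ 2) -
      x j * Real.exp (-‖R⁻¹ • x‖ ^ 2)) ^ 2 / ‖u‖ ^ ((d : ℝ) + α)) R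
  rw [finrank_euclideanSpace_fin, abs_of_pos (by positivity), smul_eq_mul,
    inv_mul_eq_div, eq_div_iff (by positivity)] at h
  rw [← h, jumpEnergy, ← integral_mul_const, ← integral_const_mul]
  congr 1 with v
  have e1 : R⁻¹ • (x + R • v) = R⁻¹ • x + v := by
    rw [smul_add, inv_smul_smul₀ hR.ne']
  have e2 : (x + R • v) j = R * (R⁻¹ • x + v) j := by
    simp [mul_add, hR.ne']
  have e3 : x j = R * (R⁻¹ • x) j := by simp [hR.ne']
  have e4 : R ^ (2 - α) * R ^ ((d : ℝ) + α) = R ^ 2 * R ^ d := by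
    rw [← Real.rpow_add hR, ← Real.rpow_natCast, ← Real.rpow_natCast, ← Real.rpow_add hR]
    congr 1
    push_cast
    ring
  have e5 : R ^ (2 - α) = R ^ 2 * R ^ d / R ^ ((d : ℝ) + α) := by
    rw [eq_div_iff (by positivity), e4]
  rw [e1, e2, e3, norm_smul R v, Real.norm_of_nonneg hR.le,
    Real.mul_rpow hR.le (norm_nonneg _), e5, gaussCoord, gaussCoord]
  simp only [div_eq_mul_inv, mul_inv]
  ring

lemma integral_gamma_div_rpow {α : ℝ} (hα : α ∈ Ioo (1 : ℝ) 2) (j : Fin d)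
    (μ : Measure (EuclideanSpace ℝ (Fin d))) {R : ℝ} (hR : 0 < R) :
    (∫ x, (1 / 2) *
        ∫ u, ((x + u) j * Real.exp (-‖R⁻¹ • (x + u)‖ ^ 2)
          - x j * Real.exp (-‖R⁻¹ • x‖ ^ 2)) ^ 2 ∂(stableLevyTilde d α) ∂μ) / R ^ (2 - α) =
      α * stableCst d α / 2 * ∫ x, jumpEnergy α j (R⁻¹ • x) ∂μ := by
  have hRα : R ^ (2 - α) ≠ 0 := (Real.rpow_pos_of_pos hR _).ne'
  simp_rw [integral_stableLevyTilde hα, integral_scaled_jump α j _ hR]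
  rw [← integral_div, ← integral_const_mul]
  congr 1 with x
  field_simp

lemma integrable_norm_rpow_mul_exp (hd : 0 < d) {s b : ℝ} (hs : 0 < s + d) (hb : 0 < b) :
    Integrable fun v : EuclideanSpace ℝ (Fin d) => ‖v‖ ^ s * Real.exp (-b * ‖v‖ ^ 2) := by
  have := nontrivial_euclideanSpace_of_pos hd
  refine (integrable_fun_norm_addHaar (volume : Measure (EuclideanSpace ℝ (Fin d)))
    (f := fun r => r ^ s * Real.exp (-b * r ^ 2))).2 ?_
  rw [finrank_euclideanSpace_fin]
  refine (integrableOn_rpow_mul_exp_neg_mul_sq hb (s := s + d - 1) (by linarith)).congr_fun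
    (fun r hr => ?_) measurableSet_Ioi
  simp only [smul_eq_mul]
  rw [← mul_assoc, pow_pred_mul_rpow hd hr]

lemma integral_norm_rpow_mul_exp (hd : 0 < d) {s b : ℝ} (hs : 0 < s + d) (hb : 0 < b) :
    ∫ v : EuclideanSpace ℝ (Fin d), ‖v‖ ^ s * Real.exp (-b * ‖v‖ ^ 2) =
      d * (volume : Measure (EuclideanSpace ℝ (Fin d))).real (Metric.ball 0 1) *
        (b ^ (-(s + d) / 2) * (1 / 2) * Real.Gamma ((s + d) / 2)) := by
  have := nontrivial_euclideanSpace_of_pos hd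
  rw [integral_fun_norm_addHaar (volume : Measure (EuclideanSpace ℝ (Fin d)))
    (fun r => r ^ s * Real.exp (-b * r ^ 2)), finrank_euclideanSpace_fin]
  have h := integral_rpow_mul_exp_neg_mul_rpow two_pos (q := s + d - 1) (by linarith) hb
  rw [sub_add_cancel] at h
  rw [← h, nsmul_eq_mul, smul_eq_mul, mul_assoc]
  congr 2
  refine setIntegral_congr_fun measurableSet_Ioi fun r hr => ?_
  simp only [smul_eq_mul, Real.rpow_two]
  rw [← mul_assoc, pow_pred_mul_rpow hd hr]

lemma integral_coord_sq_mul_eq (i j : Fin d) (h : ℝ → ℝ) :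
    ∫ v : EuclideanSpace ℝ (Fin d), v i ^ 2 * h ‖v‖ =
      ∫ v : EuclideanSpace ℝ (Fin d), v j ^ 2 * h ‖v‖ := by
  let e := LinearIsometryEquiv.piLpCongrLeft 2 ℝ ℝ (Equiv.swap i j)
  rw [← e.measurePreserving.integral_comp e.toHomeomorph.measurableEmbedding]
  congr 1 with v
  rw [e.norm_map]
  simp [e, LinearIsometryEquiv.piLpCongrLeft_apply, Equiv.piCongrLeft']

lemma integrable_coord_sq_mul (j : Fin d) {h : ℝ → ℝ} (hm : Measurable h)
    (hi : Integrable fun v : EuclideanSpace ℝ (Fin d) => ‖v‖ ^ 2 * h ‖v‖) :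
    Integrable fun v : EuclideanSpace ℝ (Fin d) => v j ^ 2 * h ‖v‖ := by
  refine hi.mono (Measurable.aestronglyMeasurable (by fun_prop)) (.of_forall fun v => ?_)
  rw [norm_mul, norm_mul, norm_pow, norm_pow, norm_norm]
  gcongr
  exact PiLp.norm_apply_le v j

lemma integral_coord_sq_mul (hd : 0 < d) (j : Fin d) {h : ℝ → ℝ} (hm : Measurable h)
    (hi : Integrable fun v : EuclideanSpace ℝ (Fin d) => ‖v‖ ^ 2 * h ‖v‖) :
    ∫ v : EuclideanSpace ℝ (Fin d), v j ^ 2 * h ‖v‖ =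
      (d : ℝ)⁻¹ * ∫ v : EuclideanSpace ℝ (Fin d), ‖v‖ ^ 2 * h ‖v‖ := by
  have hd' : (d : ℝ) ≠ 0 := by positivity
  have : ∫ v : EuclideanSpace ℝ (Fin d), ‖v‖ ^ 2 * h ‖v‖ =
      d * ∫ v : EuclideanSpace ℝ (Fin d), v j ^ 2 * h ‖v‖ := by
    simp_rw [EuclideanSpace.real_norm_sq_eq, Finset.sum_mul]
    rw [integral_finsetSum _ fun i _ => integrable_coord_sq_mul i hm hi]
    simp [integral_coord_sq_mul_eq _ j h]
  rw [this, inv_mul_cancel_left₀ hd']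

lemma sq_mul_rpow {r : ℝ} (hr : 0 ≤ r) {s : ℝ} (hs : s + 2 ≠ 0) : r ^ 2 * r ^ s = r ^ (s + 2) := by
  rw [add_comm, Real.rpow_add' hr (by rwa [add_comm]), Real.rpow_two]

lemma jumpEnergy_zero (hd : 0 < d) {α : ℝ} (hα : α ∈ Ioo (1 : ℝ) 2) (j : Fin d) :
    jumpEnergy α j 0 =
      (volume : Measure (EuclideanSpace ℝ (Fin d))).real (Metric.ball 0 1) *
        (2 ^ (-(2 - α) / 2) * (1 / 2) * Real.Gamma ((2 - α) / 2)) := by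
  obtain ⟨h1, h2⟩ := hα
  have hd1 : (1 : ℝ) ≤ d := by exact_mod_cast hd
  have key : ∀ v : EuclideanSpace ℝ (Fin d),
      ‖v‖ ^ 2 * (‖v‖ ^ (-((d : ℝ) + α)) * Real.exp (-2 * ‖v‖ ^ 2)) =
        ‖v‖ ^ (2 - α - d) * Real.exp (-2 * ‖v‖ ^ 2) := fun v => by
    rw [← mul_assoc, sq_mul_rpow (norm_nonneg v) (by linarith)]
    congr 2
    ring
  have hi := integrable_norm_rpow_mul_exp hd (s := 2 - α - d) (by linarith) two_pos
  simp_rw [← key] at hi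
  have h := integral_coord_sq_mul hd j
    (h := fun r => r ^ (-((d : ℝ) + α)) * Real.exp (-2 * r ^ 2)) (by fun_prop) hi
  simp_rw [key] at h
  rw [integral_norm_rpow_mul_exp hd (by linarith) two_pos, sub_add_cancel] at h
  calc jumpEnergy α j 0 = _ := by
        refine integral_congr_ae (.of_forall fun v => ?_)
        simp only [gaussCoord, zero_add, PiLp.zero_apply, zero_mul, sub_zero]
        rw [mul_pow, ← Real.exp_nat_mul, Real.rpow_neg (norm_nonneg v), mul_div_assoc,
          div_eq_inv_mul]
        congr 3
        push_cast
        ring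
    _ = _ := h
    _ = _ := by field_simp

/-- The kernel `‖η‖^{α−2} + η_j² (α−2) ‖η‖^{α−4}`. -/
def hessKernel (α : ℝ) (j : Fin d) (η : EuclideanSpace ℝ (Fin d)) : ℝ :=
  ‖η‖ ^ (α - 2) + η j ^ 2 * (α - 2) * ‖η‖ ^ (α - 4)

lemma measurable_hessKernel (α : ℝ) (j : Fin d) : Measurable (hessKernel α j) := by
  unfold hessKernel
  fun_prop

lemma hessKernel_mul_exp (α b : ℝ) (j : Fin d) (η : EuclideanSpace ℝ (Fin d)) :
    hessKernel α j η * Real.exp (-b * ‖η‖ ^ 2) =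
      ‖η‖ ^ (α - 2) * Real.exp (-b * ‖η‖ ^ 2) +
        (α - 2) * (η j ^ 2 * (‖η‖ ^ (α - 4) * Real.exp (-b * ‖η‖ ^ 2))) := by
  rw [hessKernel]
  ring

lemma norm_sq_mul_norm_rpow_mul_exp {α : ℝ} (hα : α < 2) (b : ℝ) (η : EuclideanSpace ℝ (Fin d)) :
    ‖η‖ ^ 2 * (‖η‖ ^ (α - 4) * Real.exp (-b * ‖η‖ ^ 2)) =
      ‖η‖ ^ (α - 2) * Real.exp (-b * ‖η‖ ^ 2) := by
  rw [← mul_assoc, sq_mul_rpow (norm_nonneg η) (by linarith)]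
  congr 2
  ring

lemma integrable_hessKernel_mul_exp (hd : 0 < d) {α b : ℝ} (hα : α ∈ Ioo (1 : ℝ) 2) (hb : 0 < b)
    (j : Fin d) :
    Integrable fun η : EuclideanSpace ℝ (Fin d) => hessKernel α j η * Real.exp (-b * ‖η‖ ^ 2) := by
  have hd1 : (1 : ℝ) ≤ d := by exact_mod_cast hd
  have hi := integrable_norm_rpow_mul_exp hd (s := α - 2) (by linarith [hα.1]) hb
  have hj := integrable_coord_sq_mul j (h := fun r => r ^ (α - 4) * Real.exp (-b * r ^ 2))
    (by fun_prop) (by simpa only [norm_sq_mul_norm_rpow_mul_exp hα.2] using hi)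
  simp_rw [hessKernel_mul_exp]
  exact hi.add (hj.const_mul _)

lemma integral_hessKernel_mul_exp (hd : 0 < d) {α b : ℝ} (hα : α ∈ Ioo (1 : ℝ) 2) (hb : 0 < b)
    (j : Fin d) :
    ∫ η : EuclideanSpace ℝ (Fin d), hessKernel α j η * Real.exp (-b * ‖η‖ ^ 2) =
      (volume : Measure (EuclideanSpace ℝ (Fin d))).real (Metric.ball 0 1) *
        (b ^ (-(α - 2 + d) / 2) * Real.Gamma ((α + d) / 2)) := by
  have hd1 : (1 : ℝ) ≤ d := by exact_mod_cast hd
  have hs : 0 < α - 2 + d := by linarith [hα.1]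
  have hi := integrable_norm_rpow_mul_exp hd hs hb
  have hi' : Integrable fun η : EuclideanSpace ℝ (Fin d) =>
      ‖η‖ ^ 2 * (‖η‖ ^ (α - 4) * Real.exp (-b * ‖η‖ ^ 2)) := by
    simpa only [norm_sq_mul_norm_rpow_mul_exp hα.2] using hi
  have hm : Measurable fun r : ℝ => r ^ (α - 4) * Real.exp (-b * r ^ 2) := by fun_prop
  have hΓ : Real.Gamma ((α + d) / 2) = (α - 2 + d) / 2 * Real.Gamma ((α - 2 + d) / 2) := by
    rw [← Real.Gamma_add_one (by positivity)]
    congr 1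
    ring
  simp_rw [hessKernel_mul_exp]
  rw [integral_add hi ((integrable_coord_sq_mul j hm hi').const_mul _), integral_const_mul,
    integral_coord_sq_mul hd j hm hi']
  simp_rw [norm_sq_mul_norm_rpow_mul_exp hα.2]
  rw [integral_norm_rpow_mul_exp hd hs hb, hΓ]
  field_simp
  ring

lemma FT_gaussian (ξ : EuclideanSpace ℝ (Fin d)) :
    FT (fun y => Real.exp (-‖y‖ ^ 2)) ξ =
      ((Real.pi ^ ((d : ℝ) / 2) * Real.exp (-(‖ξ‖ ^ 2 / 4)) : ℝ) : ℂ) := by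
  have h := GaussianFourier.integral_cexp_neg_mul_sq_norm_add (b := 1) (by simp) (-Complex.I) ξ
  rw [finrank_euclideanSpace_fin] at h
  calc FT (fun y => Real.exp (-‖y‖ ^ 2)) ξ = _ := by
        refine integral_congr_ae (.of_forall fun y => ?_)
        beta_reduce
        rw [Complex.ofReal_exp, ← Complex.exp_add]
        push_cast
        ring_nf
    _ = _ := h
    _ = _ := by
      rw [div_one, Complex.ofReal_mul, Complex.ofReal_cpow Real.pi_pos.le, Complex.ofReal_exp]
      push_cast
      congr 2
      rw [neg_sq, Complex.I_sq]
      ring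

lemma exp_mul_exp_sub (ξ η : EuclideanSpace ℝ (Fin d)) :
    Real.exp (-(‖ξ‖ ^ 2 / 4)) * Real.exp (-(‖η - ξ‖ ^ 2 / 4)) =
      Real.exp (-(1 / 8) * ‖η‖ ^ 2) * Real.exp (-(1 / 2) * ‖ξ - (1 / 2 : ℝ) • η‖ ^ 2) := by
  rw [← Real.exp_add, ← Real.exp_add, norm_sub_sq_real, norm_sub_sq_real, norm_smul,
    inner_smul_right, real_inner_comm η ξ, Real.norm_of_nonneg (by norm_num)]
  congr 1
  ring

lemma integral_gaussian_shift (w : EuclideanSpace ℝ (Fin d)) :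
    ∫ ξ : EuclideanSpace ℝ (Fin d), Real.exp (-(1 / 2) * ‖ξ - w‖ ^ 2) =
      (2 * Real.pi) ^ ((d : ℝ) / 2) := by
  rw [integral_sub_right_eq_self (fun ξ : EuclideanSpace ℝ (Fin d) =>
    Real.exp (-(1 / 2) * ‖ξ‖ ^ 2)), GaussianFourier.integral_rexp_neg_mul_sq_norm (by norm_num),
    finrank_euclideanSpace_fin]
  congr 1
  ring

lemma integral_integral_gaussian_mul (K : EuclideanSpace ℝ (Fin d) → ℝ) (hK : Measurable K)
    (hi : Integrable fun η => K η * Real.exp (-(1 / 8) * ‖η‖ ^ 2)) :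
    ∫ ξ : EuclideanSpace ℝ (Fin d), ∫ ζ : EuclideanSpace ℝ (Fin d),
        Real.exp (-(‖ξ‖ ^ 2 / 4)) * Real.exp (-(‖ζ‖ ^ 2 / 4)) * K (ξ + ζ) =
      (2 * Real.pi) ^ ((d : ℝ) / 2) * ∫ η, K η * Real.exp (-(1 / 8) * ‖η‖ ^ 2) := by
  have h1 : ∀ ξ : EuclideanSpace ℝ (Fin d), ∫ ζ : EuclideanSpace ℝ (Fin d),
        Real.exp (-(‖ξ‖ ^ 2 / 4)) * Real.exp (-(‖ζ‖ ^ 2 / 4)) * K (ξ + ζ) =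
      ∫ η, K η * Real.exp (-(1 / 8) * ‖η‖ ^ 2) *
        Real.exp (-(1 / 2) * ‖ξ - (1 / 2 : ℝ) • η‖ ^ 2) := fun ξ => by
    rw [← integral_sub_right_eq_self (μ := volume) _ ξ]
    refine integral_congr_ae (.of_forall fun η => ?_)
    beta_reduce
    rw [exp_mul_exp_sub, add_sub_cancel]
    ring
  have hg : ∀ η : EuclideanSpace ℝ (Fin d),
      Integrable fun ξ => Real.exp (-(1 / 2) * ‖ξ - (1 / 2 : ℝ) • η‖ ^ 2) := fun η =>
    .of_integral_ne_zero (by rw [integral_gaussian_shift]; positivity)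
  have hint : Integrable (Function.uncurry fun ξ η : EuclideanSpace ℝ (Fin d) =>
      K η * Real.exp (-(1 / 8) * ‖η‖ ^ 2) *
        Real.exp (-(1 / 2) * ‖ξ - (1 / 2 : ℝ) • η‖ ^ 2)) (volume.prod volume) := by
    refine (integrable_prod_iff' ?_).2 ⟨.of_forall fun η => (hg η).const_mul
      (K η * Real.exp (-(1 / 8) * ‖η‖ ^ 2)), ?_⟩
    · refine Measurable.aestronglyMeasurable ?_
      unfold Function.uncurry
      fun_prop
    · simp only [Function.uncurry_apply_pair, norm_mul (_ * _),
        Real.norm_of_nonneg (Real.exp_nonneg _)]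
      simp_rw [integral_const_mul, integral_gaussian_shift]
      exact (hi.norm).mul_const _
  simp_rw [h1]
  rw [integral_integral_swap hint]
  simp_rw [integral_const_mul, integral_gaussian_shift]
  rw [integral_mul_const, mul_comm]

lemma integral_integral_FT_gaussian (hd : 0 < d) {α : ℝ} (hα : α ∈ Ioo (1 : ℝ) 2) (j : Fin d) :
    ∫ ξ, (∫ ζ, FT (fun y : EuclideanSpace ℝ (Fin d) => Real.exp (-‖y‖ ^ 2)) ξ *
        FT (fun y => Real.exp (-‖y‖ ^ 2)) ζ *
        ((‖ξ + ζ‖ ^ (α - 2) + (ξ j + ζ j) ^ 2 * (α - 2) * ‖ξ + ζ‖ ^ (α - 4) : ℝ) : ℂ)) =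
      ((Real.pi ^ d * ((2 * Real.pi) ^ ((d : ℝ) / 2) *
        ((volume : Measure (EuclideanSpace ℝ (Fin d))).real (Metric.ball 0 1) *
          ((1 / 8) ^ (-(α - 2 + d) / 2) * Real.Gamma ((α + d) / 2)))) : ℝ) : ℂ) := by
  rw [← integral_hessKernel_mul_exp hd hα (by norm_num) j,
    ← integral_integral_gaussian_mul _ (measurable_hessKernel α j)
      (integrable_hessKernel_mul_exp hd hα (by norm_num) j)]
  simp_rw [← integral_const_mul, ← integral_complex_ofReal, FT_gaussian, ← Complex.ofReal_mul]
  refine integral_congr_ae (.of_forall fun ξ => integral_congr_ae (.of_forall fun ζ => ?_))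
  have hπ : Real.pi ^ d = Real.pi ^ ((d : ℝ) / 2) * Real.pi ^ ((d : ℝ) / 2) := by
    rw [← Real.rpow_add Real.pi_pos, add_halves, Real.rpow_natCast]
  simp only [hessKernel, hπ, PiLp.add_apply]
  congr 1
  ring

lemma stableCst_mul_Gamma_one_sub_half {α : ℝ} (hα : α ∈ Ioo (1 : ℝ) 2) (d : ℕ) :
    stableCst d α * Real.Gamma ((2 - α) / 2) =
      α * Real.Gamma ((α + d) / 2) * 2 ^ (α - 2) * Real.pi ^ (-(d : ℝ) / 2) := by
  obtain ⟨h1, h2⟩ := hα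
  have hπ := Real.pi_pos
  have hcos : Real.cos (α * Real.pi / 2) ≠ 0 := by
    refine (Real.cos_neg_of_pi_div_two_lt_of_lt ?_ ?_).ne <;> nlinarith
  have hA : Real.Gamma ((α + 1) / 2) ≠ 0 := (Real.Gamma_pos_of_pos (by positivity)).ne'
  have hD : Real.Gamma (2 - α) ≠ 0 := (Real.Gamma_pos_of_pos (by linarith)).ne'
  have hdup := Real.Gamma_mul_Gamma_add_half ((2 - α) / 2)
  have hrec := Real.Gamma_add_one (s := (1 - α) / 2) (by intro h; linarith)
  have hrefl := Real.Gamma_mul_Gamma_one_sub ((1 - α) / 2)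
  rw [show (2 - α) / 2 + 1 / 2 = (1 - α) / 2 + 1 by ring, hrec,
    show 2 * ((2 - α) / 2) = 2 - α by ring, show 1 - (2 - α) = (α - 2) + 1 by ring,
    Real.rpow_add_one two_ne_zero] at hdup
  rw [show 1 - (1 - α) / 2 = (α + 1) / 2 by ring,
    show Real.pi * ((1 - α) / 2) = Real.pi / 2 - α * Real.pi / 2 by ring, Real.sin_pi_div_two_sub,
    eq_div_iff hcos] at hrefl
  have hsq : √Real.pi * Real.pi ^ (((d : ℝ) - 1) / 2) = Real.pi ^ ((d : ℝ) / 2) := by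
    rw [Real.sqrt_eq_rpow, ← Real.rpow_add hπ]
    congr 1
    ring
  have hsqrt : √Real.pi ^ 2 = Real.pi := Real.sq_sqrt hπ.le
  have hsqrt0 : √Real.pi ≠ 0 := (Real.sqrt_pos.2 hπ).ne'
  have hp : Real.pi ^ (((d : ℝ) - 1) / 2) ≠ 0 := (Real.rpow_pos_of_pos hπ _).ne'
  rw [neg_div, Real.rpow_neg hπ.le, ← hsq, stableCst]
  set A := Real.Gamma ((α + 1) / 2)
  set B := Real.Gamma ((2 - α) / 2)
  set C := Real.Gamma ((1 - α) / 2)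
  set D := Real.Gamma (2 - α)
  set c := Real.cos (α * Real.pi / 2)
  set p := Real.pi ^ (((d : ℝ) - 1) / 2)
  set t := (2 : ℝ) ^ (α - 2)
  have key : (1 - α) * B * √Real.pi = 4 * c * A * D * t := by
    have e : (1 - α) * B * √Real.pi ^ 2 = 4 * c * A * D * t * √Real.pi := by
      rw [hsqrt]
      linear_combination (2 * A * c) * hdup - (1 - α) * B * hrefl
    exact mul_right_cancel₀ hsqrt0 (by linear_combination e)
  field_simp
  linear_combination key

lemma stableCst_mul_Gamma {α : ℝ} (hα : α ∈ Ioo (1 : ℝ) 2) (d : ℕ) :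
    α * stableCst d α / 2 * (2 ^ (-(2 - α) / 2) * (1 / 2) * Real.Gamma ((2 - α) / 2)) =
      α ^ 2 / 4 * ((2 * Real.pi) ^ (2 * d))⁻¹ * (Real.pi ^ d * ((2 * Real.pi) ^ ((d : ℝ) / 2) *
        ((1 / 8) ^ (-(α - 2 + d) / 2) * Real.Gamma ((α + d) / 2)))) := by
  have hpow : (2 : ℝ) ^ (-(2 - α) / 2) * (2 ^ (α - 2) * Real.pi ^ (-(d : ℝ) / 2)) =
      ((2 * Real.pi) ^ (2 * d))⁻¹ * (Real.pi ^ d * ((2 * Real.pi) ^ ((d : ℝ) / 2) *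
        (1 / 8) ^ (-(α - 2 + d) / 2))) := by
    have h8 : Real.log (1 / 8) = -3 * Real.log 2 := by
      rw [one_div, Real.log_inv, show (8 : ℝ) = 2 ^ 3 by norm_num, Real.log_pow]
      push_cast
      ring
    have hπ := Real.pi_pos
    rw [← Real.rpow_natCast, ← Real.rpow_natCast, ← Real.rpow_neg (by positivity),
      Real.rpow_def_of_pos two_pos, Real.rpow_def_of_pos two_pos, Real.rpow_def_of_pos hπ,
      Real.rpow_def_of_pos hπ, Real.rpow_def_of_pos (by positivity : 0 < 2 * Real.pi),
      Real.rpow_def_of_pos (by positivity : 0 < 2 * Real.pi),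
      Real.rpow_def_of_pos (by norm_num : (0 : ℝ) < 1 / 8), h8,
      Real.log_mul two_ne_zero hπ.ne']
    simp only [← Real.exp_add]
    congr 1
    push_cast
    ring
  linear_combination (α / 4 * 2 ^ (-(2 - α) / 2)) * stableCst_mul_Gamma_one_sub_half hα d +
    (α ^ 2 / 4 * Real.Gamma ((α + d) / 2)) * hpow

/-- Asymptotics of `E[Γ(g_{R,j}, g_{R,j})(X_α)]/R^{2−α}` as `R → ∞`, where
`g_{R,j}(x) = x_j exp(−‖x/R‖²)`, `Γ(f,f)(x) = ½∫ (f(x+u)−f(x))² ν̃_α(du)` and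
`X_α` is rotationally invariant `α`-stable (`lem:rate2`). -/
theorem stmt11 (d : ℕ) (hd : 0 < d) (α : ℝ) (hα : α ∈ Ioo (1 : ℝ) 2)
    (μα : Measure (EuclideanSpace ℝ (Fin d))) [IsProbabilityMeasure μα]
    (hchar : ∀ ξ, charFn μα ξ = Complex.exp (-((‖ξ‖ ^ α / 2 : ℝ) : ℂ))) :
    ∀ j : Fin d,
      Tendsto
        (fun R : ℝ =>
          (((∫ x, (1 / 2) *
              ∫ u, ((x + u) j * Real.exp (-‖R⁻¹ • (x + u)‖ ^ 2)
                  - x j * Real.exp (-‖R⁻¹ • x‖ ^ 2)) ^ 2 ∂(stableLevyTilde d α) ∂μα)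
            / R ^ (2 - α) : ℝ) : ℂ))
        atTop
        (𝓝 (((α ^ 2 / 4 : ℝ) : ℂ) * (((2 * Real.pi) ^ (2 * d) : ℝ) : ℂ)⁻¹ *
          ∫ ξ, (∫ ζ, FT (fun y => Real.exp (-‖y‖ ^ 2)) ξ * FT (fun y => Real.exp (-‖y‖ ^ 2)) ζ *
            ((‖ξ + ζ‖ ^ (α - 2) + (ξ j + ζ j) ^ 2 * (α - 2) * ‖ξ + ζ‖ ^ (α - 4) : ℝ) : ℂ)))) := by
  intro j
  have hα0 : 0 < α := by linarith [hα.1]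
  have h := (tendsto_integral_jumpEnergy hd hα0 hα.2 j μα).const_mul (α * stableCst d α / 2)
  have h' := h.congr' <| (eventually_gt_atTop 0).mono fun R hR =>
    (integral_gamma_div_rpow hα j μα hR).symm
  have hlim : α * stableCst d α / 2 * jumpEnergy α j 0 = α ^ 2 / 4 *
      ((2 * Real.pi) ^ (2 * d))⁻¹ * (Real.pi ^ d * ((2 * Real.pi) ^ ((d : ℝ) / 2) *
        ((volume : Measure (EuclideanSpace ℝ (Fin d))).real (Metric.ball 0 1) *
          ((1 / 8) ^ (-(α - 2 + d) / 2) * Real.Gamma ((α + d) / 2))))) := by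
    rw [jumpEnergy_zero hd hα j, mul_left_comm, stableCst_mul_Gamma hα d]
    ring
  rw [integral_integral_FT_gaussian hd hα j, ← Complex.ofReal_inv, ← Complex.ofReal_mul,
    ← Complex.ofReal_mul]
  rw [← hlim]
  exact (Complex.continuous_ofReal.tendsto _).comp h'
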